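/- arXiv:2306.04815 — 2 statements merged into one kernel-verified Lean document; each statement's English description precedes it below -/
import Mathlib

section
/- Batch loss increase in SGD implies the learning rate exceeds the batch critical learning rate (linearized mini-batch dynamics): let K_B ∈ ℝ^{b×b} be symmetric positive semidefinite with largest eigenvalue λ_max(K_B) and let the batch residual evolve by one step r' = (I_b − (2η/b) K_B) r with η > 0. If ‖r'‖² > ‖r‖² (the batch MSE loss increases at this step), then η > b/λ_max(K_B). -/
open Matrix

/-- For a positive semidefinite real matrix with eigenvalues at most `c`,
`‖A x‖² ≤ c ⟨x, A x⟩`. -/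
theorem Matrix.PosSemidef.mulVec_dotProduct_mulVec_le {n : Type*} [Fintype n] [DecidableEq n]
    {A : Matrix n n ℝ} (hA : A.PosSemidef) {c : ℝ} (hc : ∀ i, hA.1.eigenvalues i ≤ c)
    (x : n → ℝ) : A *ᵥ x ⬝ᵥ A *ᵥ x ≤ c * (x ⬝ᵥ A *ᵥ x) := by
  set U : Matrix n n ℝ := hA.1.eigenvectorUnitary.val
  set d := hA.1.eigenvalues
  have hspec : A = U * diagonal d * Uᵀ := by
    have h := hA.1.spectral_theorem
    rw [Unitary.conjStarAlgAut_apply] at h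
    simpa [Function.comp_def, star_eq_conjTranspose] using h
  have hUU : Uᵀ * U = 1 := by
    have h := Unitary.coe_star_mul_self hA.1.eigenvectorUnitary
    simpa [star_eq_conjTranspose] using h
  have hAx : A *ᵥ x = U *ᵥ (diagonal d *ᵥ (Uᵀ *ᵥ x)) := by
    conv_lhs => rw [hspec]
    simp only [mulVec_mulVec, Matrix.mul_assoc]
  have hdot (v w : n → ℝ) : v ⬝ᵥ U *ᵥ w = Uᵀ *ᵥ v ⬝ᵥ w := by
    rw [dotProduct_mulVec, mulVec_transpose]
  rw [hAx, hdot, hdot, mulVec_mulVec _ Uᵀ U, hUU, one_mulVec]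
  simp only [dotProduct, mulVec_diagonal, Finset.mul_sum]
  refine Finset.sum_le_sum fun i _ => ?_
  have hi : 0 ≤ d i := hA.eigenvalues_nonneg i
  nlinarith [mul_le_mul_of_nonneg_right (hc i) (mul_nonneg hi (sq_nonneg ((Uᵀ *ᵥ x) i)))]

/-- **Batch loss increase in SGD implies the learning rate exceeds the batch critical learning
rate** (linearized mini-batch dynamics). Let `K_B ∈ ℝ^{b×b}` be symmetric positive
semidefinite with largest eigenvalue `λ_max(K_B)` and let the batch residual evolve by one
step `r' = (I - (2η/b) K_B) r` with `η > 0`. If `‖r'‖² > ‖r‖²` (the batch MSE loss increases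
at this step), then `η > b / λ_max(K_B)`. -/
theorem batch_loss_increase_implies_supercritical_lr {b : ℕ}
    (KB : Matrix (Fin b) (Fin b) ℝ) (hpsd : KB.PosSemidef)
    (lamMax : ℝ)
    (hmem : ∃ i, hpsd.1.eigenvalues i = lamMax)
    (hmax : ∀ i, hpsd.1.eigenvalues i ≤ lamMax)
    (η : ℝ) (hη : 0 < η)
    (r r' : Fin b → ℝ)
    (hstep : r' = r - (2 * η / (b : ℝ)) • KB.mulVec r)
    (hinc : r' ⬝ᵥ r' > r ⬝ᵥ r) :
    η > (b : ℝ) / lamMax := by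
  obtain ⟨i, hi⟩ := hmem
  have hb : (0 : ℝ) < b := Nat.cast_pos.mpr i.pos
  have hlam : 0 ≤ lamMax := hi ▸ hpsd.eigenvalues_nonneg i
  rcases hlam.eq_or_lt with h0 | hpos
  · simpa [← h0] using hη
  by_contra! hle
  rw [le_div_iff₀ hpos] at hle
  have hKr := hpsd.mulVec_dotProduct_mulVec_le hmax r
  have hquad : 0 ≤ r ⬝ᵥ KB *ᵥ r := by
    simpa using hpsd.dotProduct_mulVec_nonneg r
  set s := 2 * η / (b : ℝ) with hs
  have hs0 : 0 < s := by positivity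
  have hs2 : s * lamMax ≤ 2 := by
    rw [hs, div_mul_eq_mul_div, div_le_iff₀ hb]
    linarith
  have hexp : r' ⬝ᵥ r' =
      r ⬝ᵥ r - 2 * s * (r ⬝ᵥ KB *ᵥ r) + s ^ 2 * (KB *ᵥ r ⬝ᵥ KB *ᵥ r) := by
    rw [hstep]
    simp only [sub_dotProduct, dotProduct_sub, smul_dotProduct, dotProduct_smul, smul_eq_mul,
      dotProduct_comm (KB *ᵥ r) r]
    ring
  have h1 := mul_le_mul_of_nonneg_left hKr (sq_nonneg s)
  have h2 := mul_le_mul_of_nonneg_right hs2 (mul_nonneg hs0.le hquad)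
  linarith
end

section
/- Approximation of the largest Hessian eigenvalue by the NTK (Appendix A of the paper): let f(w;x) be twice continuously differentiable in w, L(w) = (1/n)∑_{i=1}^n (f(w;x_i) − y_i)² the MSE loss, and K(w) the NTK matrix with K(w)_{ij} = ⟨∇_w f(w;x_i), ∇_w f(w;x_j)⟩. Then for every w, |λ_max(∇²L(w)) − (2/n)λ_max(K(w))| ≤ (2/n)∑_{i=1}^n |f(w;x_i) − y_i| · ‖∇²_w f(w;x_i)‖₂, where ‖·‖₂ is the spectral norm (operator norm) of a symmetric matrix. -/
open RealInnerProductSpace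

/-- The largest eigenvalue of a (self-adjoint) operator `T` on `ℝ^p`, expressed as the
supremum of the Rayleigh quotient `⟨v, T v⟩` over the unit sphere. -/
noncomputable def opLambdaMax {p : ℕ}
    (T : EuclideanSpace ℝ (Fin p) →L[ℝ] EuclideanSpace ℝ (Fin p)) : ℝ :=
  ⨆ v : Metric.sphere (0 : EuclideanSpace ℝ (Fin p)) 1,
    ⟪(v : EuclideanSpace ℝ (Fin p)), T v⟫

open Matrix in
theorem Matrix.IsHermitian.dotProduct_mulVec_le_iSup_eigenvalues_mul {ι : Type*} [Fintype ι]
    [DecidableEq ι] {A : Matrix ι ι ℝ} (hA : A.IsHermitian) (c : ι → ℝ) :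
    c ⬝ᵥ A *ᵥ c ≤ (⨆ i, hA.eigenvalues i) * (c ⬝ᵥ c) := by
  set b := hA.eigenvectorBasis
  have inner_eq (u v : ι → ℝ) : u ⬝ᵥ v = ⟪WithLp.toLp 2 u, WithLp.toLp 2 v⟫ := by
    simp [EuclideanSpace.inner_eq_star_dotProduct, dotProduct_comm]
  have key (j : ι) : ⟪b j, WithLp.toLp 2 (A *ᵥ c)⟫ =
      hA.eigenvalues j * ⟪b j, WithLp.toLp 2 c⟫ := by
    have h1 : (⇑(b j)) ⬝ᵥ A *ᵥ c = (A *ᵥ ⇑(b j)) ⬝ᵥ c := by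
      rw [dotProduct_mulVec, ← mulVec_transpose, ← conjTranspose_eq_transpose_of_trivial, hA.eq]
    rw [hA.mulVec_eigenvectorBasis, smul_dotProduct, inner_eq, inner_eq] at h1
    exact h1
  rw [inner_eq, inner_eq, ← b.sum_inner_mul_inner, ← b.sum_inner_mul_inner, Finset.mul_sum]
  refine Finset.sum_le_sum fun j _ => ?_
  rw [key, real_inner_comm]
  have := le_ciSup (Set.finite_range hA.eigenvalues).bddAbove j
  nlinarith [mul_le_mul_of_nonneg_right this (mul_self_nonneg ⟪b j, WithLp.toLp 2 c⟫)]

section Gram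

open Matrix

variable {E ι : Type*} [NormedAddCommGroup E] [InnerProductSpace ℝ E] [Fintype ι]

theorem norm_sum_smul_sq_eq_dotProduct_gram_mulVec (g : ι → E) (c : ι → ℝ) :
    ‖∑ i, c i • g i‖ ^ 2 = c ⬝ᵥ gram ℝ g *ᵥ c := by
  rw [← real_inner_self_eq_norm_sq, ← star_dotProduct_gram_mulVec, star_trivial]

variable [DecidableEq ι]

theorem iSup_eigenvalues_gram_nonneg (g : ι → E) (hg : (gram ℝ g).IsHermitian) :
    0 ≤ ⨆ i, hg.eigenvalues i :=
  Real.iSup_nonneg fun i => (posSemidef_gram ℝ g).eigenvalues_nonneg i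

theorem sum_inner_sq_le_iSup_eigenvalues_gram_mul (g : ι → E) (hg : (gram ℝ g).IsHermitian)
    (v : E) : ∑ i, ⟪g i, v⟫ ^ 2 ≤ (⨆ i, hg.eigenvalues i) * ‖v‖ ^ 2 := by
  set M := ⨆ i, hg.eigenvalues i
  set c : ι → ℝ := fun i => ⟪g i, v⟫
  set S := ∑ i, ⟪g i, v⟫ ^ 2
  have hS : c ⬝ᵥ c = S := by simp [dotProduct, S, c, sq]
  have hSv : S = ⟪∑ i, c i • g i, v⟫ := by
    simp [sum_inner, real_inner_smul_left, S, c, sq]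
  have hu : ‖∑ i, c i • g i‖ ^ 2 ≤ M * S := by
    rw [norm_sum_smul_sq_eq_dotProduct_gram_mulVec, ← hS]
    exact hg.dotProduct_mulVec_le_iSup_eigenvalues_mul c
  have hS0 : 0 ≤ S := Finset.sum_nonneg fun i _ => sq_nonneg _
  have hM : 0 ≤ M := iSup_eigenvalues_gram_nonneg g hg
  have hle : S ≤ ‖∑ i, c i • g i‖ * ‖v‖ := hSv ▸ real_inner_le_norm _ _
  have hsq : S * S ≤ S * (M * ‖v‖ ^ 2) := by
    calc S * S ≤ (‖∑ i, c i • g i‖ * ‖v‖) * (‖∑ i, c i • g i‖ * ‖v‖) :=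
          mul_self_le_mul_self hS0 hle
      _ = ‖∑ i, c i • g i‖ ^ 2 * ‖v‖ ^ 2 := by ring
      _ ≤ M * S * ‖v‖ ^ 2 := by gcongr
      _ = S * (M * ‖v‖ ^ 2) := by ring
  rcases hS0.eq_or_lt with h | h
  · rw [← h]
    positivity
  · exact le_of_mul_le_mul_left hsq h

theorem exists_iSup_eigenvalues_gram_le_sum_inner_sq [Nonempty ι] [Nontrivial E] (g : ι → E)
    (hg : (gram ℝ g).IsHermitian) :
    ∃ v : E, ‖v‖ = 1 ∧ ⨆ i, hg.eigenvalues i ≤ ∑ i, ⟪g i, v⟫ ^ 2 := by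
  obtain ⟨j, hj⟩ := exists_eq_ciSup_of_finite (f := hg.eigenvalues)
  rw [← hj]
  rcases ((posSemidef_gram ℝ g).eigenvalues_nonneg j).eq_or_lt with h | h
  · obtain ⟨v, hv⟩ := exists_norm_eq E zero_le_one
    exact ⟨v, hv, h.symm.trans_le (Finset.sum_nonneg fun i _ => sq_nonneg _)⟩
  set m := hg.eigenvalues j
  replace h : 0 < m := h
  set c : ι → ℝ := ⇑(hg.eigenvectorBasis j)
  have hc : gram ℝ g *ᵥ c = m • c := hg.mulVec_eigenvectorBasis j
  have hcc : c ⬝ᵥ c = 1 := by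
    have := hg.eigenvectorBasis.orthonormal.1 j
    rw [← sq_eq_sq₀ (norm_nonneg _) zero_le_one, EuclideanSpace.real_norm_sq_eq] at this
    simpa [dotProduct, sq] using this
  set u := ∑ i, c i • g i
  have hu : ‖u‖ ^ 2 = m := by
    rw [norm_sum_smul_sq_eq_dotProduct_gram_mulVec, hc, dotProduct_smul, hcc, smul_eq_mul, mul_one]
  have hgu (i : ι) : ⟪g i, u⟫ = m * c i := by
    have := congrFun hc i
    simpa [mulVec, dotProduct, u, inner_sum, real_inner_smul_right, mul_comm] using this
  have hu0 : ‖u‖ ≠ 0 := fun h0 => by simp [h0] at hu; exact h.ne hu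
  refine ⟨‖u‖⁻¹ • u, by simp [norm_smul, hu0], le_of_eq ?_⟩
  simp_rw [real_inner_smul_right, hgu, mul_pow, inv_pow, hu, ← Finset.mul_sum]
  have : ∑ i, c i ^ 2 = 1 := by simpa [dotProduct, sq] using hcc
  rw [this]
  field_simp

end Gram

section Gradient

variable {E : Type*} [NormedAddCommGroup E] [InnerProductSpace ℝ E] [CompleteSpace E]

theorem ContDiff.differentiable_gradient {f : E → ℝ} (hf : ContDiff ℝ 2 f) :
    Differentiable ℝ (gradient f) :=
  (InnerProductSpace.toDual ℝ E).symm.toContinuousLinearEquiv.differentiable.comp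
    ((hf.fderiv_right (m := 1) (by norm_num)).differentiable (by norm_num))

variable {ι : Type*} [Fintype ι]

theorem gradient_const_mul_sum_sub_sq {f : ι → E → ℝ} (hf : ∀ i, Differentiable ℝ (f i))
    (y : ι → ℝ) (a : ℝ) :
    gradient (fun w => a * ∑ i, (f i w - y i) ^ 2) =
      fun w => (2 * a) • ∑ i, (f i w - y i) • gradient (f i) w := by
  refine gradient_eq fun w => ?_
  rw [hasGradientAt_iff_hasFDerivAt]
  have h := (HasFDerivAt.fun_sum (u := Finset.univ) fun i _ =>
    (((hf i w).hasFDerivAt.sub_const (y i)).pow 2)).const_mul a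
  refine h.congr_fderiv ?_
  ext v
  simp only [map_smul, map_sum, toDual_gradient, Finset.smul_sum, smul_smul]
  simp only [sum_apply, smul_apply, smul_eq_mul]
  refine Finset.sum_congr rfl fun i _ => ?_
  rw [show 2 - 1 = 1 from rfl, pow_one, two_nsmul]
  ring

theorem inner_fderiv_gradient_const_mul_sum_sub_sq {f : ι → E → ℝ} (hf : ∀ i, ContDiff ℝ 2 (f i))
    (y : ι → ℝ) (a : ℝ) (w v : E) :
    ⟪v, fderiv ℝ (gradient fun w => a * ∑ i, (f i w - y i) ^ 2) w v⟫ =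
      (2 * a) * (∑ i, ⟪gradient (f i) w, v⟫ ^ 2 +
        ∑ i, (f i w - y i) * ⟪v, fderiv ℝ (gradient (f i)) w v⟫) := by
  have hd (i : ι) : Differentiable ℝ (f i) := (hf i).differentiable (by norm_num)
  rw [gradient_const_mul_sum_sub_sq hd]
  have h := (HasFDerivAt.fun_sum (u := Finset.univ) fun i _ =>
    ((hd i w).hasFDerivAt.sub_const (y i)).smul
      ((hf i).differentiable_gradient w).hasFDerivAt).const_smul (2 * a)
  have h' := h.fderiv
  simp only [Pi.smul_def, Pi.smul_apply'] at h'
  rw [h']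
  simp only [smul_apply, sum_apply,
    add_apply, ContinuousLinearMap.smulRight_apply, real_inner_smul_right,
    inner_sum, inner_add_right, ← Finset.sum_add_distrib]
  congr 1
  refine Finset.sum_congr rfl fun i _ => ?_
  rw [← inner_gradient_left, real_inner_comm v]
  ring

end Gradient

theorem abs_inner_apply_le_norm {E : Type*} [NormedAddCommGroup E] [InnerProductSpace ℝ E]
    (T : E →L[ℝ] E) {v : E} (hv : ‖v‖ = 1) : |⟪v, T v⟫| ≤ ‖T‖ := by
  have h := (abs_real_inner_le_norm v (T v)).trans
    (mul_le_mul_of_nonneg_left (T.le_opNorm v) (norm_nonneg v))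
  simpa [hv] using h

theorem le_opLambdaMax {p : ℕ} (T : EuclideanSpace ℝ (Fin p) →L[ℝ] EuclideanSpace ℝ (Fin p))
    {v : EuclideanSpace ℝ (Fin p)} (hv : ‖v‖ = 1) : ⟪v, T v⟫ ≤ opLambdaMax T := by
  refine le_ciSup (f := fun v : Metric.sphere (0 : EuclideanSpace ℝ (Fin p)) 1 =>
    ⟪(v : EuclideanSpace ℝ (Fin p)), T v⟫) ⟨‖T‖, ?_⟩ ⟨v, by simpa using hv⟩
  rintro _ ⟨u, rfl⟩
  exact (le_abs_self _).trans (abs_inner_apply_le_norm T (by simp))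

/-- **Approximation of the largest Hessian eigenvalue by the NTK** (Appendix A of the paper).
For a model `f i w = f(w; xᵢ)` twice continuously differentiable in `w`, the MSE loss
`L(w) = (1/n) ∑ᵢ (f i w - yᵢ)²` and NTK matrix `K(w)ᵢⱼ = ⟨∇_w f(w;xᵢ), ∇_w f(w;xⱼ)⟩`,
for every `w`:
`|λ_max(∇²L(w)) - (2/n) λ_max(K(w))| ≤ (2/n) ∑ᵢ |f(w;xᵢ) - yᵢ| · ‖∇²_w f(w;xᵢ)‖₂`,
where `‖·‖₂` is the spectral (operator) norm. -/
theorem hessian_lambda_max_ntk_approx {p n : ℕ} (hn : 0 < n)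
    (y : Fin n → ℝ)
    (f : Fin n → EuclideanSpace ℝ (Fin p) → ℝ)
    (hf : ∀ i, ContDiff ℝ 2 (f i))
    (L : EuclideanSpace ℝ (Fin p) → ℝ)
    (hL : ∀ w, L w = (1 / (n : ℝ)) * ∑ i, (f i w - y i) ^ 2)
    (K : EuclideanSpace ℝ (Fin p) → Matrix (Fin n) (Fin n) ℝ)
    (hK : ∀ w i j, K w i j = ⟪gradient (f i) w, gradient (f j) w⟫)
    (hKherm : ∀ w, (K w).IsHermitian) :
    ∀ w : EuclideanSpace ℝ (Fin p),
      |opLambdaMax (fderiv ℝ (gradient L) w) -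
          (2 / (n : ℝ)) * ⨆ i, (hKherm w).eigenvalues i| ≤
        (2 / (n : ℝ)) * ∑ i, |f i w - y i| * ‖fderiv ℝ (gradient (f i)) w‖ := by
  intro w
  obtain rfl : L = fun w => (1 / (n : ℝ)) * ∑ i, (f i w - y i) ^ 2 := funext hL
  set g : Fin n → EuclideanSpace ℝ (Fin p) := fun i => gradient (f i) w
  have hKg : K w = Matrix.gram ℝ g := Matrix.ext fun i j => hK w i j
  have hM : ⨆ i, (hKherm w).eigenvalues i =
      ⨆ i, (Matrix.isHermitian_gram ℝ g).eigenvalues i := by congr!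
  rw [hM]
  have hn' : (0 : ℝ) < n := by exact_mod_cast hn
  have : Nonempty (Fin n) := ⟨⟨0, hn⟩⟩
  set M := ⨆ i, (Matrix.isHermitian_gram ℝ g).eigenvalues i
  set H := fderiv ℝ (gradient fun w => (1 / (n : ℝ)) * ∑ i, (f i w - y i) ^ 2) w
  set B := ∑ i, |f i w - y i| * ‖fderiv ℝ (gradient (f i)) w‖
  have hquad (v : EuclideanSpace ℝ (Fin p)) : ⟪v, H v⟫ = 2 / (n : ℝ) * (∑ i, ⟪g i, v⟫ ^ 2 +
      ∑ i, (f i w - y i) * ⟪v, fderiv ℝ (gradient (f i)) w v⟫) := by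
    rw [inner_fderiv_gradient_const_mul_sum_sub_sq hf, mul_one_div]
  have hB (v : EuclideanSpace ℝ (Fin p)) (hv : ‖v‖ = 1) :
      |∑ i, (f i w - y i) * ⟪v, fderiv ℝ (gradient (f i)) w v⟫| ≤ B := by
    refine (Finset.abs_sum_le_sum_abs _ _).trans (Finset.sum_le_sum fun i _ => ?_)
    rw [abs_mul]
    exact mul_le_mul_of_nonneg_left (abs_inner_apply_le_norm _ hv) (abs_nonneg _)
  have hM0 : 0 ≤ M := iSup_eigenvalues_gram_nonneg g _
  have hB0 : 0 ≤ B := Finset.sum_nonneg fun i _ => by positivity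
  have upper : opLambdaMax H ≤ 2 / (n : ℝ) * (M + B) := by
    refine Real.iSup_le (fun v => ?_) (by positivity)
    have hv : ‖(v : EuclideanSpace ℝ (Fin p))‖ = 1 := by simp
    have hS := sum_inner_sq_le_iSup_eigenvalues_gram_mul g (Matrix.isHermitian_gram ℝ g) v
    rw [hv, one_pow, mul_one] at hS
    rw [hquad]
    gcongr
    exact (abs_le.1 (hB v hv)).2
  have lower : 2 / (n : ℝ) * (M - B) ≤ opLambdaMax H := by
    rcases subsingleton_or_nontrivial (EuclideanSpace ℝ (Fin p)) with hE | hE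
    · have hg0 : Matrix.gram ℝ g = 0 := by
        rw [Subsingleton.elim g 0, Matrix.gram_zero]
      have hMz : M = 0 := by
        simp [M, (Matrix.isHermitian_gram ℝ g).eigenvalues_eq_zero_iff.2 hg0]
      have hH : opLambdaMax H = 0 := by
        simp [opLambdaMax, Subsingleton.elim _ (0 : EuclideanSpace ℝ (Fin p))]
      rw [hMz, hH, zero_sub, mul_neg, neg_nonpos]
      positivity
    · obtain ⟨v, hv, hMv⟩ :=
        exists_iSup_eigenvalues_gram_le_sum_inner_sq g (Matrix.isHermitian_gram ℝ g)
      refine le_trans ?_ (le_opLambdaMax H hv)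
      rw [hquad, sub_eq_add_neg]
      gcongr
      exact (abs_le.1 (hB v hv)).1
  rw [abs_le]
  constructor <;> linarith
end
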